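/- Consider the hybrid system H = (C,F,D,G) on X = ℝ × [0,1] with state x = (z,τ), flow map F(x) = {(−k·|z|^α·sgn(z), 1)} on the flow set C = ℝ × [0,1], and jump map G(x) = {(−z, 0)} on the jump set D = ℝ × {1}, where α ∈ (0,1), k > 0, and sgn(z) = 1 if z ≥ 0 and sgn(z) = −1 otherwise. Let K = {0} × [0,1]. Then every maximal solution φ to H satisfies the formula ◇p at (t,j) = (0,0), where p(x) = 1 iff x ∈ K; that is, there exists (t',j') ∈ dom φ such that the z-component of φ(t',j') equals 0. -/

import Mathlib

open Set Filter Topology MeasureTheory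
open scoped ENNReal NNReal

noncomputable section

/-- The state space `ℝⁿ`. -/
abbrev ES (n : ℕ) := EuclideanSpace ℝ (Fin n)

/-- A hybrid system `H = (C,F,D,G)` on a state space `X ⊆ ℝⁿ`. -/
structure HybridSystem (n : ℕ) where
  X : Set (ES n)
  C : Set (ES n)
  F : ES n → Set (ES n)
  D : Set (ES n)
  G : ES n → Set (ES n)
  C_subset_X : C ⊆ X
  D_subset_X : D ⊆ X
  data_subset_X : closure C ∪ D ∪ (⋃ x ∈ D, G x) ⊆ X

/-- A hybrid time domain `E ⊆ [0,∞) × ℕ`. -/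
def IsHybridTimeDomain (E : Set (ℝ × ℕ)) : Prop :=
  (∀ q ∈ E, 0 ≤ q.1) ∧
  ∀ q ∈ E, ∃ τ : ℕ → ℝ, τ 0 = 0 ∧ τ (q.2 + 1) = q.1 ∧
    (∀ i : ℕ, i ≤ q.2 → τ i ≤ τ (i + 1)) ∧
    (∀ s : ℝ, ∀ j : ℕ, ((s, j) ∈ E ∧ s ≤ q.1 ∧ j ≤ q.2) ↔ (j ≤ q.2 ∧ τ j ≤ s ∧ s ≤ τ (j + 1)))

/-- A hybrid arc: a function defined on a hybrid time domain. -/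
structure HybridArc (n : ℕ) where
  dom : Set (ℝ × ℕ)
  toFun : ℝ → ℕ → ES n
  htd : IsHybridTimeDomain dom
  zero_mem : ((0 : ℝ), (0 : ℕ)) ∈ dom

variable {n : ℕ}

/-- `s` is a solution to the hybrid system `H`: the initial condition lies in
`closure C ∪ D`; on each interval `I^j` the arc is (locally) absolutely continuous,
i.e. it is the integral of an integrable selection `f` with `f t ∈ F (φ t j)` a.e.,
and `φ t j ∈ C` on the interior of `I^j`; and jumps satisfy the jump conditions. -/
structure IsSolution (H : HybridSystem n) (s : HybridArc n) : Prop where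
  init : s.toFun 0 0 ∈ closure H.C ∪ H.D
  flow : ∀ j : ℕ, ∃ f : ℝ → ES n,
    (∀ t ∈ interior {t : ℝ | (t, j) ∈ s.dom}, s.toFun t j ∈ H.C) ∧
    (∀ᵐ t ∂volume, (t, j) ∈ s.dom → f t ∈ H.F (s.toFun t j)) ∧
    (∀ a b : ℝ, (a, j) ∈ s.dom → (b, j) ∈ s.dom →
      IntervalIntegrable f volume a b ∧ s.toFun b j = s.toFun a j + ∫ u in a..b, f u)
  jump : ∀ t : ℝ, ∀ j : ℕ, (t, j) ∈ s.dom → (t, j + 1) ∈ s.dom →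
    s.toFun t j ∈ H.D ∧ s.toFun t (j + 1) ∈ H.G (s.toFun t j)

/-- `s` is a maximal solution to `H`: it is a solution that is not a proper
restriction of another solution. -/
def IsMaximal (H : HybridSystem n) (s : HybridArc n) : Prop :=
  IsSolution H s ∧
  ∀ s' : HybridArc n, IsSolution H s' → s.dom ⊆ s'.dom →
    (∀ q ∈ s.dom, s'.toFun q.1 q.2 = s.toFun q.1 q.2) → s'.dom = s.dom

/-- `s` satisfies `□ p` at `(t,j)`, where `K` is the truth set of `p`. -/
def SatAlwaysAt (s : HybridArc n) (K : Set (ES n)) (t : ℝ) (j : ℕ) : Prop :=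
  ∀ t' : ℝ, ∀ j' : ℕ, (t', j') ∈ s.dom → t + (j : ℝ) ≤ t' + (j' : ℝ) → s.toFun t' j' ∈ K

/-- `s` satisfies `◇ p` at `(t,j)`, where `K` is the truth set of `p`. -/
def SatEventuallyAt (s : HybridArc n) (K : Set (ES n)) (t : ℝ) (j : ℕ) : Prop :=
  ∃ t' : ℝ, ∃ j' : ℕ, (t', j') ∈ s.dom ∧ t + (j : ℝ) ≤ t' + (j' : ℝ) ∧ s.toFun t' j' ∈ K

/-- `s` satisfies `○ p` at `(t,j)`, where `K` is the truth set of `p`. -/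
def SatNextAt (s : HybridArc n) (K : Set (ES n)) (t : ℝ) (j : ℕ) : Prop :=
  (t, j + 1) ∈ s.dom ∧ s.toFun t (j + 1) ∈ K

/-- `s` satisfies `p U_s q` at `(t,j)`, where `P`, `Q` are the truth sets of `p`, `q`. -/
def SatUntilSAt (s : HybridArc n) (P Q : Set (ES n)) (t : ℝ) (j : ℕ) : Prop :=
  ∃ t' : ℝ, ∃ j' : ℕ, (t', j') ∈ s.dom ∧ t + (j : ℝ) ≤ t' + (j' : ℝ) ∧ s.toFun t' j' ∈ Q ∧
    ∀ t'' : ℝ, ∀ j'' : ℕ, (t'', j'') ∈ s.dom →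
      t + (j : ℝ) ≤ t'' + (j'' : ℝ) → t'' + (j'' : ℝ) < t' + (j' : ℝ) → s.toFun t'' j'' ∈ P

/-- `s` satisfies `p U_w q` at `(t,j)`. -/
def SatUntilWAt (s : HybridArc n) (P Q : Set (ES n)) (t : ℝ) (j : ℕ) : Prop :=
  (∀ t' : ℝ, ∀ j' : ℕ, (t', j') ∈ s.dom → t + (j : ℝ) ≤ t' + (j' : ℝ) → s.toFun t' j' ∈ P) ∨
  SatUntilSAt s P Q t j

/-- `s` satisfies `◇ □ p` at `(t,j)`, where `K` is the truth set of `p`. -/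
def SatEvAlwaysAt (s : HybridArc n) (K : Set (ES n)) (t : ℝ) (j : ℕ) : Prop :=
  ∃ t' : ℝ, ∃ j' : ℕ, (t', j') ∈ s.dom ∧ t + (j : ℝ) ≤ t' + (j' : ℝ) ∧
    ∀ t'' : ℝ, ∀ j'' : ℕ, (t'', j'') ∈ s.dom → t' + (j' : ℝ) ≤ t'' + (j'' : ℝ) →
      s.toFun t'' j'' ∈ K

/-- The settling time `T(φ) = inf {t+j : (t,j) ∈ dom φ, φ(t,j) ∈ K}` (with `inf ∅ = ∞`). -/
def settlingTime (s : HybridArc n) (K : Set (ES n)) : ℝ≥0∞ :=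
  sInf {e : ℝ≥0∞ | ∃ t : ℝ, ∃ j : ℕ, (t, j) ∈ s.dom ∧ s.toFun t j ∈ K ∧
    e = ENNReal.ofReal (t + (j : ℝ))}

/-- `sup_{(t,j) ∈ dom φ} (t + j)`. -/
def domSupTJ (s : HybridArc n) : ℝ≥0∞ := ⨆ q ∈ s.dom, ENNReal.ofReal (q.1 + (q.2 : ℝ))

/-- `sup_{(t,j) ∈ dom φ} t`. -/
def domSupT (s : HybridArc n) : ℝ≥0∞ := ⨆ q ∈ s.dom, ENNReal.ofReal q.1

/-- `sup_{(t,j) ∈ dom φ} j`. -/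
def domSupJ (s : HybridArc n) : ℝ≥0∞ := ⨆ q ∈ s.dom, (q.2 : ℝ≥0∞)

/-- The closed set `K` is finite time attractive (FTA) for `H` with respect to `O`:
every maximal solution from `O` satisfies `sup_{(t,j) ∈ dom φ} (t+j) ≥ T(φ)` and
`dist(φ(t,j),K) → 0` as `t+j ↗ T(φ)` along `(t,j) ∈ dom φ`. -/
def FTAwrt (H : HybridSystem n) (K O : Set (ES n)) : Prop :=
  ∀ s : HybridArc n, IsMaximal H s → s.toFun 0 0 ∈ O →
    settlingTime s K ≤ domSupTJ s ∧
    Tendsto (fun q : ℝ × ℕ => Metric.infDist (s.toFun q.1 q.2) K)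
      ((Filter.comap (fun q : ℝ × ℕ => ENNReal.ofReal (q.1 + (q.2 : ℝ)))
        (𝓝[<] (settlingTime s K))) ⊓ 𝓟 s.dom) (𝓝 0)

/-- The Clarke generalized directional derivative
`V°(x,v) = limsup_{y → x, h ↓ 0} (V(y + h v) − V(y))/h`. -/
def clarkeDeriv (V : ES n → ℝ) (x v : ES n) : ℝ :=
  limsup (fun q : ES n × ℝ => (V (q.1 + q.2 • v) - V q.1) / q.2) ((𝓝 x) ×ˢ (𝓝[>] (0 : ℝ)))

/-- `u_C(x) ≤ b`, i.e. `sup_{v ∈ F(x)} V°(x,v) ≤ b`. -/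
def uC_le (H : HybridSystem n) (V : ES n → ℝ) (x : ES n) (b : ℝ) : Prop :=
  ∀ v ∈ H.F x, clarkeDeriv V x v ≤ b

/-- `u_D(x) ≤ b`, i.e. `sup_{ζ ∈ G(x)} V(ζ) − V(x) ≤ b`. -/
def uD_le (H : HybridSystem n) (V : ES n → ℝ) (x : ES n) (b : ℝ) : Prop :=
  ∀ ζ ∈ H.G x, V ζ - V x ≤ b

/-- `V` is positive definite with respect to `K` (on `N`). -/
def PosDefWrt (V : ES n → ℝ) (K N : Set (ES n)) : Prop :=
  (∀ x ∈ K ∩ N, V x = 0) ∧ ∀ x ∈ N \ K, 0 < V x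

/-- `V` is locally Lipschitz on an open neighborhood of `S`. -/
def LocallyLipschitzOnNhdOf (V : ES n → ℝ) (S : Set (ES n)) : Prop :=
  ∃ U : Set (ES n), IsOpen U ∧ S ⊆ U ∧
    ∀ x ∈ U, ∃ L : ℝ≥0, ∃ W ∈ 𝓝 x, LipschitzOnWith L V W

/-- The sublevel set `L_V(r) = {x ∈ N : V(x) ≤ r}` for `r ∈ [0,∞]`. -/
def sublevel (V : ES n → ℝ) (N : Set (ES n)) (r : ℝ≥0∞) : Set (ES n) :=
  {x ∈ N | ENNReal.ofReal (V x) ≤ r}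

/-- `F` is outer semicontinuous on `S`. -/
def OuterSemicontinuousOn (F : ES n → Set (ES n)) (S : Set (ES n)) : Prop :=
  ∀ x ∈ S, ∀ xs : ℕ → ES n, ∀ ys : ℕ → ES n, (∀ i, xs i ∈ S) → (∀ i, ys i ∈ F (xs i)) →
    Tendsto xs atTop (𝓝 x) → ∀ y : ES n, Tendsto ys atTop (𝓝 y) → y ∈ F x

/-- `F` is locally bounded on `S`. -/
def LocallyBoundedOn (F : ES n → Set (ES n)) (S : Set (ES n)) : Prop :=
  ∀ x ∈ S, ∃ U ∈ 𝓝 x, Bornology.IsBounded (⋃ z ∈ U ∩ S, F z)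

/-- The (Bouligand) tangent cone `T_S(x)`: all `w` for which there exist `x_i ∈ S`,
`x_i → x`, `τ_i > 0`, `τ_i ↓ 0` with `(x_i − x)/τ_i → w`. -/
def BouligandTangentCone (S : Set (ES n)) (x : ES n) : Set (ES n) :=
  {w | ∃ xs : ℕ → ES n, ∃ τ : ℕ → ℝ, (∀ i, xs i ∈ S) ∧ (∀ i, 0 < τ i) ∧
    Tendsto xs atTop (𝓝 x) ∧ Tendsto τ atTop (𝓝 0) ∧
    Tendsto (fun i => (τ i)⁻¹ • (xs i - x)) atTop (𝓝 w)}

/-- `B` is a barrier function candidate with respect to `K` for `H`. -/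
def BarrierCandidate (H : HybridSystem n) (B : ES n → ℝ) (K : Set (ES n)) : Prop :=
  (∀ x ∈ K, B x ≤ 0) ∧
  ∀ x ∈ (H.C ∪ H.D ∪ ⋃ y ∈ H.D, H.G y) \ K, 0 < B x

/-- The set-valued map `F` is locally Lipschitz on `S`. -/
def SetValuedLocallyLipschitzOn (F : ES n → Set (ES n)) (S : Set (ES n)) : Prop :=
  ∀ x ∈ S, ∃ L : ℝ, 0 ≤ L ∧ ∃ U ∈ 𝓝 x,
    ∀ y ∈ U ∩ S, ∀ z ∈ U ∩ S, ∀ v ∈ F y, ∃ w ∈ F z, ‖v - w‖ ≤ L * ‖y - z‖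

/-- A positive solution of `y' = -k y^α` satisfies `(y^{1-α})' = -k (1-α)`. -/
theorem rpow_one_sub_eq_of_integral {α k a b : ℝ} {y g : ℝ → ℝ} (hab : a ≤ b)
    (hg : IntervalIntegrable g volume a b)
    (hy : ∀ t ∈ Icc a b, y t = y a + ∫ u in a..t, g u)
    (hpos : ∀ t ∈ Icc a b, 0 < y t)
    (hae : ∀ᵐ t ∂volume, t ∈ Icc a b → g t = -k * y t ^ α) :
    y b ^ (1 - α) = y a ^ (1 - α) - k * (1 - α) * (b - a) := by
  have hyc : ContinuousOn y (Icc a b) := by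
    have h := intervalIntegral.continuousOn_primitive_interval' hg left_mem_uIcc
    rw [uIcc_of_le hab] at h
    exact (continuousOn_const.add h).congr hy
  have hvc : ContinuousOn (fun t => -k * y t ^ α) (Icc a b) :=
    continuousOn_const.mul (hyc.rpow_const fun t ht => Or.inl (hpos t ht).ne')
  have hyv : ∀ t ∈ Icc a b, y t = y a + ∫ u in a..t, -k * y u ^ α := by
    intro t ht
    rw [hy t ht, intervalIntegral.integral_congr_ae]
    filter_upwards [hae] with u hu hut
    rw [uIoc_of_le ht.1] at hut
    exact hu ⟨hut.1.le, hut.2.trans ht.2⟩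
  have hderiv : ∀ x ∈ Ico a b, HasDerivWithinAt y (-k * y x ^ α) (Ici x) x := by
    intro x hx
    have hsub : Icc a x ⊆ Icc a b := Icc_subset_Icc_right hx.2.le
    have hint : IntervalIntegrable (fun t => -k * y t ^ α) volume a x := by
      apply ContinuousOn.intervalIntegrable
      rw [uIcc_of_le hx.1]
      exact hvc.mono hsub
    have hmeas : StronglyMeasurableAtFilter (fun t => -k * y t ^ α) (𝓝[>] x) volume := by
      rw [← nhdsWithin_Ioo_eq_nhdsGT hx.2]
      refine (hvc.mono fun u hu => ?_).stronglyMeasurableAtFilter_nhdsWithin measurableSet_Ioo x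
      exact ⟨hx.1.trans hu.1.le, hu.2.le⟩
    have hcont : ContinuousWithinAt (fun t => -k * y t ^ α) (Ioi x) x := by
      refine (hvc x ⟨hx.1, hx.2.le⟩).mono_of_mem_nhdsWithin ?_
      exact mem_of_superset (Ioo_mem_nhdsGT hx.2) fun u hu => ⟨hx.1.trans hu.1.le, hu.2.le⟩
    have h := (intervalIntegral.integral_hasDerivWithinAt_right hint (s := Ici x) hmeas
      hcont).const_add (y a)
    refine h.congr_of_eventuallyEq ?_ (hyv x ⟨hx.1, hx.2.le⟩)
    filter_upwards [Ico_mem_nhdsGE hx.2] with u hu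
    exact hyv u ⟨hx.1.trans hu.1, hu.2.le⟩
  have hconst := constant_of_has_deriv_right_zero
    (f := fun t => y t ^ (1 - α) + k * (1 - α) * (t - a)) (a := a) (b := b)
    ((hyc.rpow_const fun t ht => Or.inl (hpos t ht).ne').add (by fun_prop))
    (fun x hx => by
      have hx0 := hpos x ⟨hx.1, hx.2.le⟩
      have h1 := (hderiv x hx).rpow_const (p := 1 - α) (Or.inl hx0.ne')
      have h2 := (((hasDerivAt_id x).sub_const a).const_mul (k * (1 - α))).hasDerivWithinAt
        (s := Ici x)
      have h3 : y x ^ α * y x ^ (1 - α - 1) = 1 := by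
        rw [← Real.rpow_add hx0]
        simp
      refine (h1.add h2).congr_deriv ?_
      linear_combination (-k * (1 - α)) * h3)
    b ⟨hab, le_rfl⟩
  simp only [sub_self, mul_zero, add_zero] at hconst
  linarith

/-- A nonvanishing solution of `z' = -k |z|^α sgn z` keeps its sign, and `|z|^{1-α}` decreases
at the constant rate `k (1-α)`. -/
theorem mul_pos_and_abs_rpow_eq_of_integral {α k a b : ℝ} {z g : ℝ → ℝ} (hab : a ≤ b)
    (hg : IntervalIntegrable g volume a b)
    (hz : ∀ t ∈ Icc a b, z t = z a + ∫ u in a..t, g u)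
    (hne : ∀ t ∈ Icc a b, z t ≠ 0)
    (hae : ∀ᵐ t ∂volume, t ∈ Icc a b →
      g t = -k * |z t| ^ α * (if 0 ≤ z t then (1 : ℝ) else -1)) :
    0 < z a * z b ∧ |z b| ^ (1 - α) = |z a| ^ (1 - α) - k * (1 - α) * (b - a) := by
  have hzc : ContinuousOn z (Icc a b) := by
    have h := intervalIntegral.continuousOn_primitive_interval' hg left_mem_uIcc
    rw [uIcc_of_le hab] at h
    exact (continuousOn_const.add h).congr hz
  have hsign : ∀ t ∈ Icc a b, 0 < z a * z t := by
    intro t ht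
    by_contra hcon
    have hsub : uIcc a t ⊆ Icc a b := by
      rw [uIcc_of_le ht.1]
      exact Icc_subset_Icc_right ht.2
    have h0 : (0 : ℝ) ∈ uIcc (z a) (z t) := by
      rw [mem_uIcc]
      rcases mul_nonpos_iff.1 (not_lt.1 hcon) with h | h
      · exact Or.inr ⟨h.2, h.1⟩
      · exact Or.inl h
    obtain ⟨u, hu, hu0⟩ := intermediate_value_uIcc (hzc.mono hsub) h0
    exact hne u (hsub hu) hu0
  refine ⟨hsign b ⟨hab, le_rfl⟩, ?_⟩
  rcases (hne a ⟨le_rfl, hab⟩).lt_or_gt with ha | ha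
  · have hneg : ∀ t ∈ Icc a b, z t < 0 := fun t ht => by
      have := hsign t ht
      nlinarith
    have h := rpow_one_sub_eq_of_integral (α := α) (k := k) (y := fun t => -z t)
      (g := fun t => -g t) hab hg.neg
      (fun t ht => by
        rw [intervalIntegral.integral_neg, hz t ht]
        ring)
      (fun t ht => neg_pos.2 (hneg t ht))
      (by
        filter_upwards [hae] with t ht htm
        rw [ht htm, if_neg (hneg t htm).not_ge, abs_of_neg (hneg t htm)]
        ring)
    rwa [abs_of_neg ha, abs_of_neg (hneg b ⟨hab, le_rfl⟩)]
  · have hpos : ∀ t ∈ Icc a b, 0 < z t := fun t ht => pos_of_mul_pos_right (hsign t ht) ha.le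
    have h := rpow_one_sub_eq_of_integral (α := α) (k := k) hab hg hz hpos
      (by
        filter_upwards [hae] with t ht htm
        rw [ht htm, if_pos (hpos t htm).le, abs_of_pos (hpos t htm), mul_one])
    rwa [abs_of_pos ha, abs_of_pos (hpos b ⟨hab, le_rfl⟩)]

theorem hasDerivAt_max_zero_rpow {β : ℝ} (hβ : 1 < β) (x : ℝ) :
    HasDerivAt (fun u : ℝ => max 0 u ^ β) (β * max 0 x ^ (β - 1)) x := by
  have hβ0 : β ≠ 0 := by linarith
  have hβ1 : β - 1 ≠ 0 := by linarith
  rcases lt_trichotomy x 0 with hx | rfl | hx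
  · rw [max_eq_left hx.le, Real.zero_rpow hβ1, mul_zero]
    refine (hasDerivAt_const x (0 : ℝ)).congr_of_eventuallyEq ?_
    filter_upwards [Iio_mem_nhds hx] with u hu
    rw [max_eq_left (le_of_lt hu), Real.zero_rpow hβ0]
  · rw [← hasDerivWithinAt_univ, ← Iic_union_Ici (a := (0 : ℝ)), max_self]
    refine HasDerivWithinAt.union ?_ ?_
    · rw [Real.zero_rpow hβ1, mul_zero]
      refine (hasDerivWithinAt_const (0 : ℝ) (Iic 0) (0 : ℝ)).congr (fun u hu => ?_) ?_
      · rw [max_eq_left hu, Real.zero_rpow hβ0]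
      · rw [max_self, Real.zero_rpow hβ0]
    · refine (Real.hasDerivAt_rpow_const (Or.inr hβ.le)).hasDerivWithinAt.congr
        (fun u hu => ?_) ?_
      · rw [max_eq_right hu]
      · rw [max_self]
  · rw [max_eq_right hx.le]
    refine (Real.hasDerivAt_rpow_const (Or.inl hx.ne')).congr_of_eventuallyEq ?_
    filter_upwards [Ioi_mem_nhds hx] with u hu
    rw [max_eq_right (le_of_lt hu)]

/-- The solution of `z' = -k |z|^α sgn z` with value `z₀` at time `a`. -/
def finiteTimeFlow (α k a z₀ t : ℝ) : ℝ :=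
  SignType.sign z₀ * max 0 (|z₀| ^ (1 - α) - k * (1 - α) * (t - a)) ^ (1 - α)⁻¹

theorem hasDerivAt_finiteTimeFlow {α : ℝ} (hα : α ∈ Ioo (0 : ℝ) 1) (k a : ℝ) {z₀ : ℝ}
    (hz₀ : z₀ ≠ 0) (t : ℝ) :
    HasDerivAt (finiteTimeFlow α k a z₀)
      (-k * |finiteTimeFlow α k a z₀ t| ^ α *
        (if 0 ≤ finiteTimeFlow α k a z₀ t then (1 : ℝ) else -1)) t := by
  have h1 : 0 < 1 - α := sub_pos.2 hα.2
  have hβ : 1 < (1 - α)⁻¹ := (one_lt_inv₀ h1).2 (by linarith [hα.1])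
  set m := |z₀| ^ (1 - α) - k * (1 - α) * (t - a) with hm
  have hexp : (1 - α)⁻¹ - 1 = (1 - α)⁻¹ * α := by
    field_simp
    ring
  have hinner : HasDerivAt (fun t => |z₀| ^ (1 - α) - k * (1 - α) * (t - a))
      (-(k * (1 - α))) t := by
    simpa using (((hasDerivAt_id t).sub_const a).const_mul (k * (1 - α))).const_sub
      (|z₀| ^ (1 - α))
  have hd := ((hasDerivAt_max_zero_rpow hβ m).comp t hinner).const_mul
    ((SignType.sign z₀ : SignType) : ℝ)
  refine hd.congr_deriv ?_
  have hP : 0 ≤ max 0 m := le_max_left _ _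
  have hcancel : (1 - α)⁻¹ * (1 - α) = 1 := inv_mul_cancel₀ h1.ne'
  have hval : finiteTimeFlow α k a z₀ t = SignType.sign z₀ * max 0 m ^ (1 - α)⁻¹ := rfl
  rw [hval, hexp]
  rcases hP.eq_or_lt with h0 | h0
  · rw [← h0, Real.zero_rpow (by linarith : (1 - α)⁻¹ ≠ 0),
      Real.zero_rpow (mul_ne_zero (by linarith) hα.1.ne')]
    simp [Real.zero_rpow hα.1.ne']
  · have hpow := Real.rpow_pos_of_pos h0 (1 - α)⁻¹
    rcases hz₀.lt_or_gt with hz | hz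
    · rw [sign_neg hz]
      have hlt : ((-1 : SignType) : ℝ) * max 0 m ^ (1 - α)⁻¹ < 0 := by simpa using hpow
      rw [if_neg hlt.not_ge, abs_of_neg hlt, Real.rpow_mul hP]
      simp only [SignType.coe_neg_one, neg_mul, one_mul, neg_neg, mul_neg, mul_one]
      linear_combination (k * (max 0 m ^ (1 - α)⁻¹) ^ α) * hcancel
    · rw [sign_pos hz]
      simp only [SignType.coe_one, one_mul]
      rw [if_pos hpow.le, abs_of_pos hpow, Real.rpow_mul hP]
      linear_combination (-k * (max 0 m ^ (1 - α)⁻¹) ^ α) * hcancel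

/-- Two nonzero values of the same sign on the same decreasing profile of `|z|^{1-α}` are joined
by the explicit flow. -/
theorem eq_finiteTimeFlow {α k a t z₀ z : ℝ} (hα : α < 1) (hsign : 0 < z₀ * z)
    (hz : |z| ^ (1 - α) = |z₀| ^ (1 - α) - k * (1 - α) * (t - a)) :
    z = finiteTimeFlow α k a z₀ t := by
  have h1 : 1 - α ≠ 0 := (sub_pos.2 hα).ne'
  rw [finiteTimeFlow, ← hz, max_eq_right (Real.rpow_nonneg (abs_nonneg z) _),
    Real.rpow_rpow_inv (abs_nonneg z) h1]
  rcases pos_and_pos_or_neg_and_neg_of_mul_pos hsign with h | h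
  · simp [sign_pos h.1, abs_of_pos h.2]
  · simp [sign_neg h.1, abs_of_neg h.2]

theorem abs_finiteTimeFlow_rpow_mul_sign {α : ℝ} (hα : 0 < α) (k a : ℝ) {z₀ : ℝ} (hz₀ : z₀ ≠ 0)
    (t : ℝ) :
    -k * |finiteTimeFlow α k a z₀ t| ^ α *
        (if 0 ≤ finiteTimeFlow α k a z₀ t then (1 : ℝ) else -1) =
      -k * |finiteTimeFlow α k a z₀ t| ^ α * SignType.sign z₀ := by
  rcases eq_or_ne (finiteTimeFlow α k a z₀ t) 0 with h | h
  · simp [h, Real.zero_rpow hα.ne']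
  · have hP : 0 ≤ max 0 (|z₀| ^ (1 - α) - k * (1 - α) * (t - a)) ^ (1 - α)⁻¹ :=
      Real.rpow_nonneg (le_max_left _ _) _
    congr 1
    rcases hz₀.lt_or_gt with hz | hz
    · have hle : finiteTimeFlow α k a z₀ t ≤ 0 := by
        rw [finiteTimeFlow, sign_neg hz]
        simpa using hP
      rw [if_neg (hle.lt_of_ne h).not_ge, sign_neg hz]
      simp
    · have hge : 0 ≤ finiteTimeFlow α k a z₀ t := by
        rw [finiteTimeFlow, sign_pos hz]
        simpa using hP
      rw [if_pos hge, sign_pos hz]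
      simp

namespace IsHybridTimeDomain

variable {E : Set (ℝ × ℕ)}

theorem ordConnected_slice (hE : IsHybridTimeDomain E) (j : ℕ) :
    OrdConnected {t : ℝ | (t, j) ∈ E} := by
  refine ⟨fun a ha b hb t ht => ?_⟩
  obtain ⟨τ, -, hτ, -, h⟩ := hE.2 (b, j) hb
  have h1 := (h a j).1 ⟨ha, ht.1.trans ht.2, le_rfl⟩
  exact ((h t j).2 ⟨le_rfl, h1.2.1.trans ht.1, ht.2.trans hτ.ge⟩).1

theorem exists_jump_le (hE : IsHybridTimeDomain E) {t : ℝ} {j : ℕ} (h : (t, j + 1) ∈ E) :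
    ∃ c ≤ t, (c, j) ∈ E ∧ (c, j + 1) ∈ E := by
  obtain ⟨τ, -, hτ, hmono, hiff⟩ := hE.2 _ h
  have h1 : τ (j + 1) ≤ t := (hmono (j + 1) le_rfl).trans hτ.le
  exact ⟨τ (j + 1), h1, ((hiff _ j).2 ⟨j.le_succ, hmono j j.le_succ, le_rfl⟩).1,
    ((hiff _ (j + 1)).2 ⟨le_rfl, le_rfl, hmono (j + 1) le_rfl⟩).1⟩

theorem notMem_of_lt (hE : IsHybridTimeDomain E) {J : ℕ} (hJ : ∀ t, (t, J + 1) ∉ E) {j : ℕ}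
    (hj : J < j) (t : ℝ) : (t, j) ∉ E := by
  induction j, hj using Nat.le_induction generalizing t with
  | base => exact hJ t
  | succ j _ ih =>
    intro h
    obtain ⟨c, -, hc, -⟩ := hE.exists_jump_le h
    exact ih c hc

theorem le_of_lt (hE : IsHybridTimeDomain E)
    (hmono : ∀ s t j, (s, j) ∈ E → (t, j + 1) ∈ E → s ≤ t) {s t : ℝ} {i j : ℕ} (hij : i < j)
    (hs : (s, i) ∈ E) (ht : (t, j) ∈ E) : s ≤ t := by
  induction j, hij using Nat.le_induction generalizing t with
  | base => exact hmono s t i hs ht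
  | succ j _ ih =>
    obtain ⟨c, hct, hc, -⟩ := hE.exists_jump_le ht
    exact (ih hc).trans hct

/-- A hybrid time domain with last jump index `J` can be prolonged by flowing from `(a, J)` up to
`(b, J)` and then jumping. -/
theorem flow_jump (hE : IsHybridTimeDomain E)
    (hmono : ∀ s t j, (s, j) ∈ E → (t, j + 1) ∈ E → s ≤ t) {a b : ℝ} {J : ℕ} (ha : (a, J) ∈ E)
    (hab : a ≤ b) (hJ : ∀ t, (t, J + 1) ∉ E) :
    IsHybridTimeDomain {q | q ∈ E ∨ (q.2 = J ∧ a ≤ q.1 ∧ q.1 ≤ b) ∨ q = (b, J + 1)} := by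
  have hlast : ∀ t j, (t, j) ∈ E → j ≤ J := fun t j h =>
    not_lt.1 fun hj => hE.notMem_of_lt hJ hj t h
  have ha0 : 0 ≤ a := hE.1 _ ha
  obtain ⟨τ, hτ0, hτ, hτmono, hiff⟩ := hE.2 _ ha
  dsimp only at hτ hτmono hiff
  have hcut : ∀ t, a ≤ t → ∀ s j, j ≤ J →
      (((s, j) ∈ E ∨ (j = J ∧ a ≤ s ∧ s ≤ b)) ∧ s ≤ t ∧ t ≤ b ↔
        t ≤ b ∧ τ j ≤ s ∧ s ≤ if j < J then τ (j + 1) else t) := by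
    intro t hat s j hj
    have hi := hiff s j
    rcases hj.lt_or_eq with hj' | rfl
    · rw [if_pos hj']
      constructor
      · rintro ⟨h | h, hst, htb⟩
        · exact ⟨htb, (hi.1 ⟨h, hE.le_of_lt hmono hj' h ha, hj⟩).2⟩
        · omega
      · rintro ⟨htb, h⟩
        have := hi.2 ⟨hj, h⟩
        exact ⟨Or.inl this.1, this.2.1.trans hat, htb⟩
    · rw [if_neg (lt_irrefl _)]
      have hτa : τ j ≤ a := (hτmono j le_rfl).trans hτ.le
      constructor
      · rintro ⟨h | h, hst, htb⟩
        · refine ⟨htb, ?_, hst⟩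
          rcases le_total s a with hsa | hsa
          · exact (hi.1 ⟨h, hsa, hj⟩).2.1
          · exact hτa.trans hsa
        · exact ⟨htb, hτa.trans h.2.1, hst⟩
      · rintro ⟨htb, h1, h2⟩
        refine ⟨?_, h2, htb⟩
        rcases le_total s a with hsa | hsa
        · exact Or.inl (hi.2 ⟨hj, h1, hsa.trans hτ.ge⟩).1
        · exact Or.inr ⟨rfl, hsa, h2.trans htb⟩
  refine ⟨?_, ?_⟩
  · rintro q (h | h | rfl)
    · exact hE.1 q h
    · exact ha0.trans h.2.1
    · exact ha0.trans hab
  · rintro ⟨t, j⟩ (h | ⟨rfl, hat, htb⟩ | h)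
    · obtain ⟨σ, hσ0, hσ, hσmono, hσiff⟩ := hE.2 _ h
      refine ⟨σ, hσ0, hσ, hσmono, fun s i => ?_⟩
      rw [← hσiff s i]
      dsimp only at *
      have hjJ := hlast t j h
      refine ⟨?_, fun h' => ⟨Or.inl h'.1, h'.2⟩⟩
      rintro ⟨h' | ⟨h1, h2, h3⟩ | h', hst, hij⟩
      · exact ⟨h', hst, hij⟩
      · dsimp only at h1 h2 h3
        obtain rfl : j = J := by omega
        subst h1
        exact ⟨(hE.ordConnected_slice i).out ha h ⟨h2, hst⟩, hst, hij⟩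
      · have := congrArg Prod.snd h'
        dsimp only at this
        omega
    · dsimp only at hat htb hcut ⊢
      refine ⟨fun i => if i ≤ j then τ i else t, ?_, ?_, ?_, ?_⟩
      · simp [hτ0]
      · simp
      · intro i hi
        rcases hi.lt_or_eq with hi' | rfl
        · simpa [hi, Nat.succ_le_iff.2 hi'] using hτmono i hi
        · simpa using ((hτmono i le_rfl).trans hτ.le).trans hat
      · intro s i
        by_cases hi : i ≤ j
        · have := hcut t hat s i hi
          simp only [hi, if_true, Nat.succ_le_iff, true_and, and_true, htb, Prod.mk.injEq,
            mem_ofPred_eq] at this ⊢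
          rw [← this]
          have : i ≠ j + 1 := by omega
          simp [this]
        · simp [hi]
    · obtain ⟨rfl, rfl⟩ := Prod.mk.inj h
      dsimp only
      refine ⟨fun i => if i ≤ J then τ i else t, ?_, ?_, ?_, ?_⟩
      · simp [hτ0]
      · simp
      · intro i hi
        rcases hi.lt_or_eq with hi' | rfl
        · rcases (Nat.lt_succ_iff.1 hi').lt_or_eq with hi'' | rfl
          · simpa [hi''.le, Nat.succ_le_iff.2 hi''] using hτmono i hi''.le
          · simpa using ((hτmono i le_rfl).trans hτ.le).trans hab
        · simp
      · intro s i
        by_cases hi : i ≤ J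
        · have := hcut t hab s i hi
          have hi1 : i ≤ J + 1 := by omega
          simp only [hi, hi1, if_true, Nat.succ_le_iff, true_and, and_true, le_refl,
            Prod.mk.injEq, mem_ofPred_eq] at this ⊢
          rw [← this]
          have : i ≠ J + 1 := by omega
          simp [this]
        · by_cases hi1 : i = J + 1
          · subst hi1
            have h1 : ∀ u, (u, J + 1) ∉ E := hJ
            simp only [mem_ofPred_eq, h1, false_or, hi, if_false, Prod.mk.injEq, le_refl,
              and_true, true_and]
            constructor
            · rintro ⟨h | h, -⟩
              · omega
              · simp [h]
            · intro h
              have h2 : ¬ J + 1 + 1 ≤ J := by omega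
              rw [if_neg h2] at h
              exact ⟨Or.inr (le_antisymm h.2 h.1), h.2⟩
          · have : ¬ i ≤ J + 1 := by omega
            simp [this]

end IsHybridTimeDomain

theorem EuclideanSpace.intervalIntegral_apply {f : ℝ → ES n} {a b : ℝ}
    (hf : IntervalIntegrable f volume a b) (i : Fin n) :
    (∫ u in a..b, f u) i = ∫ u in a..b, f u i :=
  ((EuclideanSpace.proj (𝕜 := ℝ) i).intervalIntegral_comp_comm hf).symm

theorem EuclideanSpace.intervalIntegrable_apply {f : ℝ → ES n} {a b : ℝ}
    (hf : IntervalIntegrable f volume a b) (i : Fin n) :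
    IntervalIntegrable (fun u => f u i) volume a b :=
  ⟨(EuclideanSpace.proj (𝕜 := ℝ) i).integrable_comp hf.1,
    (EuclideanSpace.proj (𝕜 := ℝ) i).integrable_comp hf.2⟩

/-- The data of the system with flow `(z, τ)' = (-k |z|^α sgn z, 1)` and jump `(z, τ) ↦ (-z, 0)`
triggered by `τ = 1`. -/
structure IsFiniteTimeSystem (α k : ℝ) (H : HybridSystem 2) : Prop where
  C_eq : H.C = {x : ES 2 | x 1 ∈ Icc (0 : ℝ) 1}
  F_eq : ∀ x : ES 2, H.F x =
    {v : ES 2 | v 0 = -k * |x 0| ^ α * (if 0 ≤ x 0 then (1 : ℝ) else -1) ∧ v 1 = 1}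
  D_eq : H.D = {x : ES 2 | x 1 = 1}
  G_eq : ∀ x : ES 2, H.G x = {v : ES 2 | v 0 = -x 0 ∧ v 1 = 0}

namespace IsFiniteTimeSystem

variable {α k : ℝ} {H : HybridSystem 2} {s : HybridArc 2}

theorem jump_eq (hH : IsFiniteTimeSystem α k H) (hs : IsSolution H s) {t : ℝ} {j : ℕ}
    (h : (t, j) ∈ s.dom) (h' : (t, j + 1) ∈ s.dom) :
    s.toFun t j 1 = 1 ∧ s.toFun t (j + 1) 0 = -s.toFun t j 0 ∧ s.toFun t (j + 1) 1 = 0 := by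
  have := hs.jump t j h h'
  rw [hH.D_eq, hH.G_eq] at this
  exact this

theorem timer_eq (hH : IsFiniteTimeSystem α k H) (hs : IsSolution H s) {a b : ℝ} {j : ℕ}
    (hab : a ≤ b) (ha : (a, j) ∈ s.dom) (hb : (b, j) ∈ s.dom) :
    s.toFun b j 1 = s.toFun a j 1 + (b - a) := by
  obtain ⟨f, -, hf, hint⟩ := hs.flow j
  obtain ⟨hi, he⟩ := hint a b ha hb
  rw [he, PiLp.add_apply, EuclideanSpace.intervalIntegral_apply hi,
    intervalIntegral.integral_congr_ae (g := fun _ => (1 : ℝ))]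
  · simp
  · filter_upwards [hf] with u hu hum
    rw [uIoc_of_le hab] at hum
    have := hu ((s.htd.ordConnected_slice j).out ha hb ⟨hum.1.le, hum.2⟩)
    rw [hH.F_eq] at this
    exact this.2

theorem timer_mem_of_le (hH : IsFiniteTimeSystem α k H) (hs : IsSolution H s) {a b : ℝ} {j : ℕ}
    (hab : a ≤ b) (ha : (a, j) ∈ s.dom) (hb : (b, j) ∈ s.dom)
    (h : s.toFun a j 1 ∈ Icc (0 : ℝ) 1) : s.toFun b j 1 ∈ Icc (0 : ℝ) 1 := by
  have hord := s.htd.ordConnected_slice j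
  rcases hab.eq_or_lt with rfl | hab'
  · exact h
  have hτ := hH.timer_eq hs hab ha hb
  refine ⟨by linarith [h.1], ?_⟩
  have hlt : ∀ u ∈ Ioo a b, u ≤ a + 1 - s.toFun a j 1 := by
    intro u hu
    obtain ⟨f, hC, -⟩ := hs.flow j
    have hmem : u ∈ interior {t : ℝ | (t, j) ∈ s.dom} :=
      mem_interior.2 ⟨Ioo a b, fun v hv => hord.out ha hb ⟨hv.1.le, hv.2.le⟩, isOpen_Ioo, hu⟩
    have hCu := hC u hmem
    rw [hH.C_eq] at hCu
    have h1 : s.toFun u j 1 ≤ 1 := hCu.2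
    have h2 := hH.timer_eq hs hu.1.le ha (hord.out ha hb ⟨hu.1.le, hu.2.le⟩)
    linarith
  have : b ≤ a + 1 - s.toFun a j 1 := by
    refine le_of_forall_lt_imp_le_of_dense fun u hu => ?_
    rcases le_or_gt u a with hua | hua
    · linarith [h.2]
    · exact hlt u ⟨hua, hu⟩
  linarith

theorem timer_mem (hH : IsFiniteTimeSystem α k H) (hs : IsSolution H s) {t : ℝ} {j : ℕ}
    (h : (t, j) ∈ s.dom) : s.toFun t j 1 ∈ Icc (0 : ℝ) 1 := by
  induction j generalizing t with
  | zero =>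
    refine hH.timer_mem_of_le hs (s.htd.1 _ h) s.zero_mem h ?_
    have hinit := hs.init
    have hclosed : IsClosed {x : ES 2 | x 1 ∈ Icc (0 : ℝ) 1} :=
      isClosed_Icc.preimage (by fun_prop : Continuous fun x : ES 2 => x 1)
    rw [hH.C_eq, hH.D_eq, hclosed.closure_eq] at hinit
    rcases hinit with h0 | h0
    · exact h0
    · have h1 : s.toFun 0 0 1 = 1 := h0
      rw [h1]
      exact ⟨zero_le_one, le_rfl⟩
  | succ j ih =>
    obtain ⟨c, hct, hc, hc'⟩ := s.htd.exists_jump_le h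
    refine hH.timer_mem_of_le hs hct hc' h ?_
    rw [(hH.jump_eq hs hc hc').2.2]
    exact ⟨le_rfl, zero_le_one⟩

theorem le_of_mem_succ (hH : IsFiniteTimeSystem α k H) (hs : IsSolution H s) (t u : ℝ) (j : ℕ)
    (ht : (t, j) ∈ s.dom) (hu : (u, j + 1) ∈ s.dom) : t ≤ u := by
  obtain ⟨c, hcu, hc, hc'⟩ := s.htd.exists_jump_le hu
  by_contra! hut
  have h1 := hH.timer_eq hs (hcu.trans hut.le) hc ht
  rw [(hH.jump_eq hs hc hc').1] at h1
  linarith [(hH.timer_mem hs ht).2]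

theorem sub_one_add_timer_le (hH : IsFiniteTimeSystem α k H) (hs : IsSolution H s) {t : ℝ} {j : ℕ}
    (h : (t, j) ∈ s.dom) : (j : ℝ) - 1 + s.toFun t j 1 ≤ t := by
  induction j generalizing t with
  | zero =>
    have h1 := hH.timer_eq hs (s.htd.1 _ h) s.zero_mem h
    have h2 := (hH.timer_mem hs s.zero_mem).2
    push_cast
    linarith
  | succ j ih =>
    obtain ⟨c, hct, hc, hc'⟩ := s.htd.exists_jump_le h
    have h1 := ih hc
    have h2 := hH.timer_eq hs hct hc' h
    obtain ⟨h3, -, h4⟩ := hH.jump_eq hs hc hc'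
    push_cast
    linarith

theorem mul_pos_and_abs_rpow_eq (hH : IsFiniteTimeSystem α k H) (hs : IsSolution H s)
    (hne : ∀ t j, (t, j) ∈ s.dom → s.toFun t j 0 ≠ 0) {a b : ℝ} {j : ℕ}
    (hab : a ≤ b) (ha : (a, j) ∈ s.dom) (hb : (b, j) ∈ s.dom) :
    0 < s.toFun a j 0 * s.toFun b j 0 ∧
      |s.toFun b j 0| ^ (1 - α) = |s.toFun a j 0| ^ (1 - α) - k * (1 - α) * (b - a) := by
  have hmem : ∀ t ∈ Icc a b, (t, j) ∈ s.dom := fun t ht =>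
    (s.htd.ordConnected_slice j).out ha hb ht
  obtain ⟨f, -, hf, hint⟩ := hs.flow j
  refine mul_pos_and_abs_rpow_eq_of_integral (z := fun t => s.toFun t j 0)
    (g := fun t => f t 0) hab (EuclideanSpace.intervalIntegrable_apply (hint a b ha hb).1 0)
    (fun t ht => ?_) (fun t ht => hne t j (hmem t ht)) ?_
  · obtain ⟨hi, he⟩ := hint a t ha (hmem t ht)
    simp only [he, PiLp.add_apply, EuclideanSpace.intervalIntegral_apply hi]
  · filter_upwards [hf] with t ht htm
    have := ht (hmem t htm)
    rw [hH.F_eq] at this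
    exact this.1

theorem abs_rpow_eq (hH : IsFiniteTimeSystem α k H) (hs : IsSolution H s)
    (hne : ∀ t j, (t, j) ∈ s.dom → s.toFun t j 0 ≠ 0) {t : ℝ} {j : ℕ} (h : (t, j) ∈ s.dom) :
    |s.toFun t j 0| ^ (1 - α) = |s.toFun 0 0 0| ^ (1 - α) - k * (1 - α) * t := by
  induction j generalizing t with
  | zero => simpa using (hH.mul_pos_and_abs_rpow_eq hs hne (s.htd.1 _ h) s.zero_mem h).2
  | succ j ih =>
    obtain ⟨c, hct, hc, hc'⟩ := s.htd.exists_jump_le h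
    have h1 := (hH.mul_pos_and_abs_rpow_eq hs hne hct hc' h).2
    rw [(hH.jump_eq hs hc hc').2.1, abs_neg, ih hc] at h1
    rw [h1]
    ring

theorem toFun_eq_flow (hH : IsFiniteTimeSystem α k H) (hα : α < 1) (hs : IsSolution H s)
    (hne : ∀ t j, (t, j) ∈ s.dom → s.toFun t j 0 ≠ 0) {a t : ℝ} {j : ℕ}
    (ha : (a, j) ∈ s.dom) (ht : (t, j) ∈ s.dom) :
    s.toFun t j = !₂[finiteTimeFlow α k a (s.toFun a j 0) t, s.toFun a j 1 + (t - a)] := by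
  have h0 : s.toFun t j 0 = finiteTimeFlow α k a (s.toFun a j 0) t := by
    rcases le_total a t with hat | hat
    · obtain ⟨h1, h2⟩ := hH.mul_pos_and_abs_rpow_eq hs hne hat ha ht
      exact eq_finiteTimeFlow hα h1 h2
    · obtain ⟨h1, h2⟩ := hH.mul_pos_and_abs_rpow_eq hs hne hat ht ha
      exact eq_finiteTimeFlow hα (by rwa [mul_comm]) (by linarith)
  have h1 : s.toFun t j 1 = s.toFun a j 1 + (t - a) := by
    rcases le_total a t with hat | hat
    · exact hH.timer_eq hs hat ha ht
    · linarith [hH.timer_eq hs hat ht ha]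
  ext i
  fin_cases i
  · simpa using h0
  · simpa using h1

/-- The explicit flow is an integral curve of the flow map. -/
theorem exists_flow_selection (hH : IsFiniteTimeSystem α k H) (hα : α ∈ Ioo (0 : ℝ) 1) {z₀ : ℝ}
    (hz₀ : z₀ ≠ 0) (a τ₀ : ℝ) :
    ∃ f : ℝ → ES 2, (∀ t, f t ∈ H.F !₂[finiteTimeFlow α k a z₀ t, τ₀ + (t - a)]) ∧
      ∀ b c : ℝ, IntervalIntegrable f volume b c ∧
        (!₂[finiteTimeFlow α k a z₀ c, τ₀ + (c - a)] : ES 2) =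
          !₂[finiteTimeFlow α k a z₀ b, τ₀ + (b - a)] + ∫ u in b..c, f u := by
  have hd : ∀ t, HasDerivAt (finiteTimeFlow α k a z₀)
      (-k * |finiteTimeFlow α k a z₀ t| ^ α * SignType.sign z₀) t := fun t => by
    rw [← abs_finiteTimeFlow_rpow_mul_sign hα.1 k a hz₀ t]
    exact hasDerivAt_finiteTimeFlow hα k a hz₀ t
  have hc : Continuous (finiteTimeFlow α k a z₀) :=
    continuous_iff_continuousAt.2 fun t => (hd t).continuousAt
  have hg : Continuous fun t =>
      -k * |finiteTimeFlow α k a z₀ t| ^ α * ((SignType.sign z₀ : SignType) : ℝ) :=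
    (continuous_const.mul (hc.abs.rpow_const fun _ => Or.inr hα.1.le)).mul continuous_const
  have hf : Continuous fun t =>
      (!₂[-k * |finiteTimeFlow α k a z₀ t| ^ α * ((SignType.sign z₀ : SignType) : ℝ), 1] :
        ES 2) := by
    fun_prop
  refine ⟨_, fun t => ?_, fun b c => ⟨hf.intervalIntegrable b c, ?_⟩⟩
  · rw [hH.F_eq]
    exact ⟨(abs_finiteTimeFlow_rpow_mul_sign hα.1 k a hz₀ t).symm, rfl⟩
  · ext i
    rw [PiLp.add_apply, EuclideanSpace.intervalIntegral_apply (hf.intervalIntegrable b c)]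
    fin_cases i
    · have := intervalIntegral.integral_eq_sub_of_hasDerivAt (fun t _ => hd t)
        (hg.intervalIntegrable b c)
      simp only [Fin.zero_eta, Matrix.cons_val_zero]
      linarith
    · simp
      ring

/-- A solution avoiding `z = 0` whose last jump index is `J` is a proper restriction of another
solution. -/
theorem exists_prolongation (hH : IsFiniteTimeSystem α k H) (hα : α ∈ Ioo (0 : ℝ) 1)
    (hs : IsSolution H s) (hne : ∀ t j, (t, j) ∈ s.dom → s.toFun t j 0 ≠ 0) {a : ℝ} {J : ℕ}
    (ha : (a, J) ∈ s.dom) (hJ : ∀ t, (t, J + 1) ∉ s.dom) :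
    ∃ s' : HybridArc 2, IsSolution H s' ∧ s.dom ⊆ s'.dom ∧
      (∀ q ∈ s.dom, s'.toFun q.1 q.2 = s.toFun q.1 q.2) ∧ ∃ b, (b, J + 1) ∈ s'.dom := by
  set b := a + 1 - s.toFun a J 1 with hb
  have hτa := hH.timer_mem hs ha
  have hab : a ≤ b := by linarith [hτa.2]
  set ψ : ℝ → ES 2 := fun t =>
    !₂[finiteTimeFlow α k a (s.toFun a J 0) t, s.toFun a J 1 + (t - a)]
  have hψeq : ∀ t, (t, J) ∈ s.dom → s.toFun t J = ψ t := fun t ht =>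
    hH.toFun_eq_flow hα.2 hs hne ha ht
  have hmono := hH.le_of_mem_succ hs
  have hlast : ∀ t j, J < j → (t, j) ∉ s.dom := fun t j hj => s.htd.notMem_of_lt hJ hj t
  let s' : HybridArc 2 :=
    { dom := {q | q ∈ s.dom ∨ (q.2 = J ∧ a ≤ q.1 ∧ q.1 ≤ b) ∨ q = (b, J + 1)}
      toFun := fun t j => if j = J then ψ t else if j = J + 1 then !₂[-ψ b 0, 0] else s.toFun t j
      htd := s.htd.flow_jump hmono ha hab hJ
      zero_mem := Or.inl s.zero_mem }
  have hmem : ∀ t j, (t, j) ∈ s'.dom ↔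
      (t, j) ∈ s.dom ∨ (j = J ∧ a ≤ t ∧ t ≤ b) ∨ (t = b ∧ j = J + 1) := fun t j => by
    simp [s']
  have hmem_ne : ∀ t j, j ≠ J → j ≠ J + 1 → ((t, j) ∈ s'.dom ↔ (t, j) ∈ s.dom) :=
    fun t j h1 h2 => by simp [hmem, h1, h2]
  have hmem_succ : ∀ t, (t, J + 1) ∈ s'.dom ↔ t = b := fun t => by simp [hmem, hJ]
  have hψ' : ∀ t, s'.toFun t J = ψ t := fun t => by simp [s']
  have hfun_ne : ∀ t j, j ≠ J → j ≠ J + 1 → s'.toFun t j = s.toFun t j :=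
    fun t j h1 h2 => by simp [s', h1, h2]
  have hagree : ∀ t j, (t, j) ∈ s.dom → s'.toFun t j = s.toFun t j := by
    intro t j h
    rcases eq_or_ne j J with rfl | h1
    · rw [hψ', hψeq t h]
    · rcases eq_or_ne j (J + 1) with rfl | h2
      · exact absurd h (hJ t)
      · exact hfun_ne t j h1 h2
  refine ⟨s', ⟨?_, fun j => ?_, fun t j ht ht' => ?_⟩, fun q hq => Or.inl hq,
    fun q hq => hagree q.1 q.2 hq, b, (hmem_succ b).2 rfl⟩
  · rw [hagree 0 0 s.zero_mem]
    exact hs.init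
  · rcases eq_or_ne j J with rfl | h1
    · obtain ⟨f, hf, hint⟩ := hH.exists_flow_selection hα (hne a j ha) a (s.toFun a j 1)
      refine ⟨f, fun t ht => ?_, Eventually.of_forall fun t _ => ?_, fun c d _ _ => ?_⟩
      · rw [hψ', hH.C_eq]
        have hts : t ∈ {t : ℝ | (t, j) ∈ s'.dom} := interior_subset ht
        rcases (hmem t j).1 hts with h | ⟨-, h, h'⟩ | ⟨-, h⟩
        · rw [← hψeq t h]
          exact hH.timer_mem hs h
        · change s.toFun a j 1 + (t - a) ∈ Icc (0 : ℝ) 1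
          exact ⟨by linarith [hτa.1], by linarith⟩
        · omega
      · rw [hψ']
        exact hf t
      · rw [hψ', hψ']
        exact hint c d
    · rcases eq_or_ne j (J + 1) with rfl | h2
      · have hset : {t : ℝ | (t, J + 1) ∈ s'.dom} = {b} := by
          ext t
          exact hmem_succ t
        refine ⟨0, fun t ht => ?_, ?_, fun c d hc hd => ?_⟩
        · rw [hset, interior_singleton] at ht
          exact ht.elim
        · filter_upwards [Measure.ae_ne volume b] with t ht h
          exact absurd ((hmem_succ t).1 h) ht
        · rw [(hmem_succ c).1 hc, (hmem_succ d).1 hd]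
          simp
      · obtain ⟨f, hC, hF, hint⟩ := hs.flow j
        refine ⟨f, ?_, ?_, ?_⟩
        · simpa only [hmem_ne _ j h1 h2, hfun_ne _ j h1 h2] using hC
        · simpa only [hmem_ne _ j h1 h2, hfun_ne _ j h1 h2] using hF
        · simpa only [hmem_ne _ j h1 h2, hfun_ne _ j h1 h2] using hint
  · rcases lt_trichotomy j J with hj | rfl | hj
    · have h1 : (t, j) ∈ s.dom := (hmem_ne t j (by omega) (by omega)).1 ht
      have h2 : (t, j + 1) ∈ s.dom := by
        rcases (hmem t (j + 1)).1 ht' with h | ⟨rfl, h, -⟩ | ⟨-, h⟩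
        · exact h
        · rwa [le_antisymm (hmono t a j h1 ha) h]
        · omega
      rw [hagree t j h1, hagree t (j + 1) h2]
      exact hs.jump t j h1 h2
    · obtain rfl := (hmem_succ t).1 ht'
      rw [hψ', hH.D_eq, hH.G_eq]
      have h1 : s'.toFun b (j + 1) = !₂[-ψ b 0, 0] := by simp [s']
      rw [h1]
      refine ⟨?_, rfl, rfl⟩
      change s.toFun a j 1 + (b - a) = 1
      linarith
    · exact absurd ((hmem_ne t (j + 1) (by omega) (by omega)).1 ht') (hlast t _ (by omega))

end IsFiniteTimeSystem

/-- every maximal solution to the finite-time-convergent planar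
system satisfies `◇p` at `(0,0)` with `K = {0} × [0,1]`. -/
theorem finite_time_example_eventually
    (α k : ℝ) (hα : α ∈ Ioo (0 : ℝ) 1) (hk : 0 < k)
    (H : HybridSystem 2)
    (hX : H.X = {x : ES 2 | x 1 ∈ Icc (0 : ℝ) 1})
    (hC : H.C = {x : ES 2 | x 1 ∈ Icc (0 : ℝ) 1})
    (hF : ∀ x : ES 2, H.F x =
      {v : ES 2 | v 0 = -k * |x 0| ^ α * (if 0 ≤ x 0 then (1 : ℝ) else -1) ∧ v 1 = 1})
    (hD : H.D = {x : ES 2 | x 1 = 1})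
    (hG : ∀ x : ES 2, H.G x = {v : ES 2 | v 0 = -x 0 ∧ v 1 = 0})
    (K : Set (ES 2))
    (hK : K = {x : ES 2 | x 0 = 0 ∧ x 1 ∈ Icc (0 : ℝ) 1}) :
    ∀ s : HybridArc 2, IsMaximal H s →
      ∃ t' : ℝ, ∃ j' : ℕ, (t', j') ∈ s.dom ∧ s.toFun t' j' ∈ K := by
  intro s hs
  have hH : IsFiniteTimeSystem α k H := ⟨hC, hF, hD, hG⟩
  by_contra! hcon
  have hne : ∀ t j, (t, j) ∈ s.dom → s.toFun t j 0 ≠ 0 := fun t j h h0 => by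
    refine hcon t j h ?_
    rw [hK]
    exact ⟨h0, hH.timer_mem hs.1 h⟩
  have hex : ∀ j, ∃ t, (t, j) ∈ s.dom := by
    intro j
    induction j with
    | zero => exact ⟨0, s.zero_mem⟩
    | succ j ih =>
      by_contra! hJ
      obtain ⟨a, ha⟩ := ih
      obtain ⟨s', hs', hsub, hagree, b, hb⟩ := hH.exists_prolongation hα hs.1 hne ha hJ
      rw [hs.2 s' hs' hsub hagree] at hb
      exact hJ b hb
  have hc : 0 < k * (1 - α) := mul_pos hk (sub_pos.2 hα.2)
  obtain ⟨j, hj⟩ := exists_nat_gt (|s.toFun 0 0 0| ^ (1 - α) / (k * (1 - α)) + 1)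
  obtain ⟨t, ht⟩ := hex j
  have h1 := hH.sub_one_add_timer_le hs.1 ht
  have h2 := (hH.timer_mem hs.1 ht).1
  have h3 := hH.abs_rpow_eq hs.1 hne ht
  have h4 : 0 ≤ |s.toFun t j 0| ^ (1 - α) := Real.rpow_nonneg (abs_nonneg _) _
  have h5 : |s.toFun 0 0 0| ^ (1 - α) / (k * (1 - α)) < t := by linarith
  rw [div_lt_iff₀ hc] at h5
  linarith
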